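/- Under the hypotheses of the augmented Lagrangian descent lemma (X convex, f L_f-smooth, h convex, |cᵢ| ≤ F, ‖∇cᵢ‖₂ ≤ M_c, cᵢ L_c-smooth, |λᵢ^k| ≤ ρF, v 1-strongly convex w.r.t. the ℓ_q-norm with 2 ≤ p and 1/p + 1/q = 1, x^{k+1} = argmin_{x∈X} ⟨s^k + ∇c(x^k)ᵀ(λ^k + μc(x^k)), x⟩ + h(x) + (1/η)V(x^k, x), λ^{k+1} = λ^k + ρ_k c(x^k), ε^k = s^k − g_ν(x^k)), assume additionally that η L_μ ≤ 1/2, where L_μ = L_f + m(μM_c² + μF L_c + ρF L_c). Then ‖x^{k+1} − x^k‖_q² ≤ 4η·( L(x^k, λ^k; μ) − L(x^{k+1}, λ^{k+1}; μ) + m ρ_k F² ) + η²ν²L_f²·E_u[‖u‖₂⁶] + 4η²‖ε^k‖_p². -/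

import Mathlib

open MeasureTheory Finset
open scoped RealInnerProductSpace

/-- The ℓ_p norm on ℝ^d. -/
noncomputable def lpNorm {d : ℕ} (p : ℝ) (x : EuclideanSpace ℝ (Fin d)) : ℝ :=
  (∑ i, |x i| ^ p) ^ (1 / p)

/-- The augmented Lagrangian `L(x, λ; μ) = f(x) + h(x) + λᵀc(x) + (μ/2)‖c(x)‖₂²`. -/
noncomputable def AL {d m : ℕ} (f h : EuclideanSpace ℝ (Fin d) → ℝ)
    (c : Fin m → EuclideanSpace ℝ (Fin d) → ℝ) (μ : ℝ)
    (x : EuclideanSpace ℝ (Fin d)) (lam : Fin m → ℝ) : ℝ :=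
  f x + h x + ∑ i, lam i * c i x + μ / 2 * ∑ i, (c i x) ^ 2

/-- Descent lemma: a function with `L`-Lipschitz gradient on a convex set deviates from its
linearization by at most `L / 2 * ‖y - x‖ ^ 2`. -/
theorem abs_sub_sub_inner_le_of_lipschitz_gradient {E : Type*} [NormedAddCommGroup E]
    [InnerProductSpace ℝ E] [CompleteSpace E] {S : Set E} (hS : Convex ℝ S) {φ : E → ℝ}
    {φ' : E → E} {L : ℝ} (hφ : ∀ x, HasGradientAt φ (φ' x) x)
    (hL : ∀ x ∈ S, ∀ y ∈ S, ‖φ' x - φ' y‖ ≤ L * ‖x - y‖) {x y : E} (hx : x ∈ S) (hy : y ∈ S) :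
    |φ y - φ x - ⟪φ' x, y - x⟫| ≤ L / 2 * ‖y - x‖ ^ 2 := by
  have hline : ∀ t : ℝ, HasDerivAt (fun t : ℝ => x + t • (y - x)) (y - x) t := fun t => by
    simpa using ((hasDerivAt_id t).smul_const (y - x)).const_add x
  have hderiv : ∀ t : ℝ, HasDerivAt (fun t : ℝ => φ (x + t • (y - x)) - φ x - t * ⟪φ' x, y - x⟫)
      (⟪φ' (x + t • (y - x)) - φ' x, y - x⟫) t := fun t => by
    have h1 := (hφ (x + t • (y - x))).hasFDerivAt.comp_hasDerivAt t (hline t)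
    have h2 := (h1.sub_const (φ x)).sub ((hasDerivAt_id t).mul_const ⟪φ' x, y - x⟫)
    refine h2.congr_deriv ?_
    simp [inner_sub_left]
  have hB : ∀ t : ℝ, HasDerivAt (fun t : ℝ => L / 2 * ‖y - x‖ ^ 2 * t ^ 2)
      (L * ‖y - x‖ ^ 2 * t) t := fun t => by
    refine ((hasDerivAt_pow 2 t).const_mul (L / 2 * ‖y - x‖ ^ 2)).congr_deriv ?_
    push_cast
    ring
  have key := image_norm_le_of_norm_deriv_right_le_deriv_boundary' (a := 0) (b := 1)
    (fun t _ => (hderiv t).continuousAt.continuousWithinAt)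
    (fun t _ => (hderiv t).hasDerivWithinAt) (by simp)
    (fun t _ => (hB t).continuousAt.continuousWithinAt)
    (fun t _ => (hB t).hasDerivWithinAt)
    (fun t ht => by
      have hmem : x + t • (y - x) ∈ S := hS.add_smul_sub_mem hx hy ⟨ht.1, ht.2.le⟩
      calc ‖⟪φ' (x + t • (y - x)) - φ' x, y - x⟫‖
          ≤ ‖φ' (x + t • (y - x)) - φ' x‖ * ‖y - x‖ := norm_inner_le_norm _ _
        _ ≤ L * ‖x + t • (y - x) - x‖ * ‖y - x‖ := by gcongr; exact hL _ hmem _ hx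
        _ = L * ‖y - x‖ ^ 2 * t := by
            rw [add_sub_cancel_left, norm_smul, Real.norm_of_nonneg ht.1]; ring)
    (Set.right_mem_Icc.2 zero_le_one)
  simpa using key

theorem lpNorm_euclidean_nonneg {d : ℕ} (p : ℝ) (x : EuclideanSpace ℝ (Fin d)) : 0 ≤ lpNorm p x :=
  Real.rpow_nonneg (sum_nonneg fun _ _ => Real.rpow_nonneg (abs_nonneg _) _) _

theorem lpNorm_rpow_eq_sum {d : ℕ} {p : ℝ} (hp : p ≠ 0) (x : EuclideanSpace ℝ (Fin d)) :
    lpNorm p x ^ p = ∑ i, |x i| ^ p := by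
  rw [_root_.lpNorm, one_div,
    Real.rpow_inv_rpow (sum_nonneg fun _ _ => Real.rpow_nonneg (abs_nonneg _) _) hp]

theorem abs_apply_le_lpNorm {d : ℕ} {p : ℝ} (hp : 0 < p) (x : EuclideanSpace ℝ (Fin d))
    (i : Fin d) : |x i| ≤ lpNorm p x := by
  rw [← Real.rpow_le_rpow_iff (abs_nonneg _) (lpNorm_euclidean_nonneg p x) hp, lpNorm_rpow_eq_sum hp.ne']
  exact single_le_sum (f := fun j => |x j| ^ p)
    (fun _ _ => Real.rpow_nonneg (abs_nonneg _) _) (mem_univ i)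

theorem norm_le_lpNorm {d : ℕ} {q : ℝ} (hq : 0 < q) (hq2 : q ≤ 2)
    (x : EuclideanSpace ℝ (Fin d)) : ‖x‖ ≤ lpNorm q x := by
  have hD := lpNorm_euclidean_nonneg q x
  refine (sq_le_sq₀ (norm_nonneg x) hD).1 ?_
  have split : ∀ {a : ℝ}, 0 ≤ a → a ^ 2 = a ^ q * a ^ (2 - q) := fun {a} ha => by
    rw [← Real.rpow_add' ha (by norm_num), add_sub_cancel, Real.rpow_two]
  rw [EuclideanSpace.norm_sq_eq, split hD, lpNorm_rpow_eq_sum hq.ne', sum_mul]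
  refine sum_le_sum fun i _ => ?_
  rw [Real.norm_eq_abs, split (abs_nonneg _)]
  gcongr
  exact abs_apply_le_lpNorm hq x i

theorem abs_inner_le_lpNorm_mul_lpNorm {d : ℕ} {p q : ℝ} (hpq : p.HolderConjugate q)
    (x y : EuclideanSpace ℝ (Fin d)) : |⟪x, y⟫| ≤ lpNorm p x * lpNorm q y := by
  have key : ∀ z : EuclideanSpace ℝ (Fin d), ⟪z, y⟫ ≤ lpNorm p z * lpNorm q y := fun z => by
    rw [PiLp.inner_apply]
    simpa [_root_.lpNorm, mul_comm (z.ofLp _)] using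
      Real.inner_le_Lp_mul_Lq univ (fun i => z i) (fun i => y i) hpq
  refine abs_le.2 ⟨?_, key x⟩
  have := key (-x)
  rw [inner_neg_left, show _root_.lpNorm p (-x) = _root_.lpNorm p x by simp [_root_.lpNorm]] at this
  linarith

/-- First-order optimality for the minimization of a differentiable function plus a convex one. -/
theorem inner_gradient_add_sub_nonneg_of_isMinOn {E : Type*} [NormedAddCommGroup E]
    [InnerProductSpace ℝ E] [CompleteSpace E] {S : Set E} (hS : Convex ℝ S) {φ h : E → ℝ}
    {g x z : E} (hφ : HasGradientAt φ g x) (hh : ConvexOn ℝ Set.univ h) (hx : x ∈ S) (hz : z ∈ S)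
    (hmin : IsMinOn (fun y => φ y + h y) S x) : 0 ≤ ⟪g, z - x⟫ + (h z - h x) := by
  have hline : HasDerivAt (fun t : ℝ => x + t • (z - x)) (z - x) 0 := by
    simpa using ((hasDerivAt_id (0 : ℝ)).smul_const (z - x)).const_add x
  have hφ0 : HasGradientAt φ g (x + (0 : ℝ) • (z - x)) := by simpa using hφ
  have hderiv : HasDerivAt (fun t : ℝ => φ (x + t • (z - x)) + t * (h z - h x))
      (⟪g, z - x⟫ + (h z - h x)) 0 := by
    simpa using! (hφ0.hasFDerivAt.comp_hasDerivAt (0 : ℝ) hline).fun_add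
      ((hasDerivAt_id (0 : ℝ)).mul_const (h z - h x))
  refine ge_of_tendsto hderiv.tendsto_slope_zero_right ?_
  filter_upwards [Ioo_mem_nhdsGT (zero_lt_one (α := ℝ))] with t ht
  have hconv : h (x + t • (z - x)) ≤ h x + t * (h z - h x) := by
    have := hh.2 (Set.mem_univ x) (Set.mem_univ z) (sub_nonneg.2 ht.2.le) ht.1.le (by ring)
    rw [show x + t • (z - x) = (1 - t) • x + t • z by module]
    simp only [smul_eq_mul] at this
    linarith
  have hle := isMinOn_iff.1 hmin _ (hS.add_smul_sub_mem hx hz ⟨ht.1.le, ht.2.le⟩)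
  simp only [zero_add, zero_smul, add_zero, zero_mul, smul_eq_mul]
  exact mul_nonneg (inv_nonneg.2 ht.1.le) (by linarith)

/-- Bias of the smoothed gradient of a function with `L`-Lipschitz gradient. -/
theorem inner_sub_smoothed_gradient_le {d : ℕ} {f : EuclideanSpace ℝ (Fin d) → ℝ}
    {f' : EuclideanSpace ℝ (Fin d) → EuclideanSpace ℝ (Fin d)} {L ν : ℝ} (hν : 0 < ν)
    (hf : ∀ x, HasGradientAt f (f' x) x) (hL : ∀ x y, ‖f' x - f' y‖ ≤ L * ‖x - y‖)
    {Ω : Type*} [MeasurableSpace Ω] {P : Measure Ω} [IsProbabilityMeasure P]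
    {u : Ω → EuclideanSpace ℝ (Fin d)} (hu : Measurable u)
    (hmom : Integrable (fun ω => ‖u ω‖ ^ 3) P)
    (hId : ∀ i j, (∫ ω, u ω i * u ω j ∂P) = if i = j then (1 : ℝ) else 0)
    (x w : EuclideanSpace ℝ (Fin d)) :
    ⟪f' x - ∫ ω, ((f (x + ν • u ω) - f x) / ν) • u ω ∂P, w⟫
      ≤ ν * L / 2 * (∫ ω, ‖u ω‖ ^ 3 ∂P) * ‖w‖ := by
  have hfc : Continuous f := continuous_iff_continuousAt.2 fun z => (hf z).continuousAt
  have hquot : ∀ ω, |(f (x + ν • u ω) - f x) / ν - ⟪f' x, u ω⟫| ≤ ν * L / 2 * ‖u ω‖ ^ 2 := by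
    intro ω
    have := abs_sub_sub_inner_le_of_lipschitz_gradient convex_univ hf (fun a _ b _ => hL a b)
      (Set.mem_univ x) (Set.mem_univ (x + ν • u ω))
    rw [add_sub_cancel_left, inner_smul_right, norm_smul, Real.norm_of_nonneg hν.le] at this
    rw [show (f (x + ν • u ω) - f x) / ν - ⟪f' x, u ω⟫
      = (f (x + ν • u ω) - f x - ν * ⟪f' x, u ω⟫) / ν by field_simp, abs_div, abs_of_pos hν,
      div_le_iff₀ hν]
    linarith
  have hsq : Integrable (fun ω => ‖u ω‖ ^ 2) P := by
    refine ((integrable_const (1 : ℝ)).fun_add hmom).mono' (by fun_prop) (.of_forall fun ω => ?_)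
    rw [Real.norm_of_nonneg (by positivity)]
    have := norm_nonneg (u ω)
    nlinarith [mul_nonneg this (sq_nonneg (‖u ω‖ - 1)), sq_nonneg (‖u ω‖ - 1)]
  have hprod : ∀ i j, Integrable (fun ω => u ω i * u ω j) P := fun i j => by
    refine hsq.mono' (by fun_prop) (.of_forall fun ω => ?_)
    rw [norm_mul, sq]
    gcongr <;> exact PiLp.norm_apply_le _ _
  have hlin : Integrable (fun ω => ⟪f' x, u ω⟫ • u ω) P := by
    refine (hsq.const_mul ‖f' x‖).mono' (by fun_prop) (.of_forall fun ω => ?_)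
    rw [norm_smul, sq, ← mul_assoc]
    gcongr
    exact norm_inner_le_norm _ _
  have hrem_le : ∀ ω, ‖((f (x + ν • u ω) - f x) / ν - ⟪f' x, u ω⟫) • u ω‖
      ≤ ν * L / 2 * ‖u ω‖ ^ 3 := fun ω => by
    rw [norm_smul, pow_succ, ← mul_assoc]
    gcongr
    exact hquot ω
  have hrem : Integrable (fun ω => ((f (x + ν • u ω) - f x) / ν - ⟪f' x, u ω⟫) • u ω) P := by
    refine (hmom.const_mul (ν * L / 2)).mono' ?_ (.of_forall hrem_le)
    have : Measurable fun ω => f (x + ν • u ω) := hfc.measurable.comp (by fun_prop)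
    exact Measurable.aestronglyMeasurable (by fun_prop)
  have hmean : ∫ ω, ⟪f' x, u ω⟫ • u ω ∂P = f' x := by
    refine ext_inner_right ℝ fun z => ?_
    rw [real_inner_comm, ← integral_inner hlin z]
    have hexp : ∀ ω, ⟪z, ⟪f' x, u ω⟫ • u ω⟫ = ∑ i, ∑ j, f' x i * z j * (u ω i * u ω j) := by
      intro ω
      rw [inner_smul_right, PiLp.inner_apply, PiLp.inner_apply, sum_mul_sum]
      refine sum_congr rfl fun i _ => sum_congr rfl fun j _ => ?_
      simp
      ring
    simp_rw [hexp]
    rw [integral_finsetSum _ fun i _ => integrable_finsetSum _ fun j _ => (hprod i j).const_mul _]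
    simp_rw [integral_finsetSum _ fun j _ => (hprod _ j).const_mul _, integral_const_mul, hId]
    simp [PiLp.inner_apply, mul_comm]
  have hsplit : f' x - ∫ ω, ((f (x + ν • u ω) - f x) / ν) • u ω ∂P
      = -∫ ω, ((f (x + ν • u ω) - f x) / ν - ⟪f' x, u ω⟫) • u ω ∂P := by
    conv_lhs => rw [← hmean]
    rw [← neg_sub, ← integral_sub _ hlin]
    · simp_rw [sub_smul]
    · simpa [sub_smul] using hrem.fun_add hlin
  rw [hsplit]
  refine (real_inner_le_norm _ _).trans ?_
  rw [norm_neg, ← integral_const_mul]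
  gcongr
  exact norm_integral_le_of_norm_le (hmom.const_mul _) (.of_forall hrem_le)

/-- The gradient of `f + ∑ i, λᵢ cᵢ + μ / 2 * ∑ i, cᵢ ^ 2`. -/
theorem hasGradientAt_add_sum_penalty {E ι : Type*} [NormedAddCommGroup E]
    [InnerProductSpace ℝ E] [CompleteSpace E] [Fintype ι] {f : E → ℝ} {c : ι → E → ℝ}
    {g x : E} {c' : ι → E} (hf : HasGradientAt f g x) (hc : ∀ i, HasGradientAt (c i) (c' i) x)
    (μ : ℝ) (lam : ι → ℝ) :
    HasGradientAt (fun y => f y + ∑ i, lam i * c i y + μ / 2 * ∑ i, (c i y) ^ 2)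
      (g + ∑ i, (lam i + μ * c i x) • c' i) x := by
  rw [hasGradientAt_iff_hasFDerivAt]
  have h1 := HasFDerivAt.fun_sum (u := univ) fun i _ => (hc i).hasFDerivAt.const_mul (lam i)
  have h2 := HasFDerivAt.fun_sum (u := univ) fun i _ => (hc i).hasFDerivAt.pow 2
  refine ((hf.hasFDerivAt.add h1).add (h2.const_mul (μ / 2))).congr_fderiv ?_
  ext z
  simp [add_assoc, mul_sum, ← sum_add_distrib]
  refine sum_congr rfl fun i _ => ?_
  ring

/-- On a convex set where the constraints are bounded with bounded Lipschitz gradients, the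
smooth part of the augmented Lagrangian has a Lipschitz gradient. -/
theorem norm_gradient_add_sum_penalty_sub_le {E ι : Type*} [NormedAddCommGroup E]
    [InnerProductSpace ℝ E] [CompleteSpace E] [Fintype ι] {X : Set E} (hX : Convex ℝ X)
    {f' : E → E} {c : ι → E → ℝ} {c' : ι → E → E} {lam : ι → ℝ} {μ Lf F Mc Lc R : ℝ}
    (hμ : 0 ≤ μ) (hLf : ∀ x ∈ X, ∀ y ∈ X, ‖f' x - f' y‖ ≤ Lf * ‖x - y‖)
    (hdc : ∀ i x, HasGradientAt (c i) (c' i x) x) (hcF : ∀ i, ∀ x ∈ X, |c i x| ≤ F)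
    (hgc : ∀ i, ∀ x ∈ X, ‖c' i x‖ ≤ Mc)
    (hcL : ∀ i, ∀ x ∈ X, ∀ y ∈ X, ‖c' i x - c' i y‖ ≤ Lc * ‖x - y‖)
    (hlam : ∀ i, |lam i| ≤ R) {x y : E} (hx : x ∈ X) (hy : y ∈ X) :
    ‖(f' x + ∑ i, (lam i + μ * c i x) • c' i x) - (f' y + ∑ i, (lam i + μ * c i y) • c' i y)‖
      ≤ (Lf + Fintype.card ι * (μ * Mc ^ 2 + μ * F * Lc + R * Lc)) * ‖x - y‖ := by
  have hterm : ∀ i, ‖(lam i + μ * c i x) • c' i x - (lam i + μ * c i y) • c' i y‖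
      ≤ (μ * Mc ^ 2 + μ * F * Lc + R * Lc) * ‖x - y‖ := fun i => by
    have hlip : ‖c i x - c i y‖ ≤ Mc * ‖x - y‖ :=
      hX.norm_image_sub_le_of_norm_hasFDerivWithin_le
        (fun z _ => (hdc i z).hasFDerivAt.hasFDerivWithinAt)
        (fun z hz => by simpa using hgc i z hz) hy hx
    have hcoef : ‖lam i + μ * c i x‖ ≤ R + μ * F := by
      refine (norm_add_le _ _).trans (add_le_add (hlam i) ?_)
      rw [norm_mul, Real.norm_of_nonneg hμ]
      exact mul_le_mul_of_nonneg_left (hcF i x hx) hμ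
    have hMc : 0 ≤ Mc := (norm_nonneg _).trans (hgc i x hx)
    calc ‖(lam i + μ * c i x) • c' i x - (lam i + μ * c i y) • c' i y‖
        = ‖(lam i + μ * c i x) • (c' i x - c' i y) + (μ * (c i x - c i y)) • c' i y‖ := by
          congr 1; module
      _ ≤ ‖lam i + μ * c i x‖ * ‖c' i x - c' i y‖ + μ * ‖c i x - c i y‖ * ‖c' i y‖ := by
          refine (norm_add_le _ _).trans_eq ?_
          rw [norm_smul, norm_smul, norm_mul, Real.norm_of_nonneg hμ]
      _ ≤ (R + μ * F) * (Lc * ‖x - y‖) + μ * (Mc * ‖x - y‖) * Mc := by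
          have hnn : 0 ≤ R + μ * F := (norm_nonneg _).trans hcoef
          gcongr
          exacts [hcL i x hx y hy, hgc i y hy]
      _ = (μ * Mc ^ 2 + μ * F * Lc + R * Lc) * ‖x - y‖ := by ring
  rw [add_sub_add_comm, ← sum_sub_distrib, add_mul]
  refine (norm_add_le _ _).trans (add_le_add (hLf x hx y hy) ((norm_sum_le _ _).trans ?_))
  refine (sum_le_sum fun i _ => hterm i).trans_eq ?_
  simp [mul_assoc]

/-- one-step bound on `‖x^{k+1} − x^k‖_q²` under the additional stepsize
condition `η L_μ ≤ 1/2`, where `L_μ = L_f + m(μ M_c² + μ F L_c + ρ F L_c)`. -/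
theorem step_length_bound
    {d m : ℕ} {p q η μ ρ ρk ν Lf F Mc Lc : ℝ}
    (hp : 2 ≤ p) (hpq : 1 / p + 1 / q = 1)
    (hη : 0 < η) (hμ : 0 < μ) (hρ : 0 < ρ) (hρk : 0 ≤ ρk) (hν : 0 < ν)
    (X : Set (EuclideanSpace ℝ (Fin d)))
    (hXne : X.Nonempty) (hXcl : IsClosed X) (hXconv : Convex ℝ X)
    -- `f` is `L_f`-smooth
    (f : EuclideanSpace ℝ (Fin d) → ℝ)
    (f' : EuclideanSpace ℝ (Fin d) → EuclideanSpace ℝ (Fin d))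
    (hdf : ∀ x, HasGradientAt f (f' x) x)
    (hLf : ∀ x y, ‖f' x - f' y‖ ≤ Lf * ‖x - y‖)
    -- `h` is convex
    (h : EuclideanSpace ℝ (Fin d) → ℝ) (hconv : ConvexOn ℝ Set.univ h)
    -- constraints
    (c : Fin m → EuclideanSpace ℝ (Fin d) → ℝ)
    (c' : Fin m → EuclideanSpace ℝ (Fin d) → EuclideanSpace ℝ (Fin d))
    (hdc : ∀ i x, HasGradientAt (c i) (c' i x) x)
    (hcF : ∀ i, ∀ x ∈ X, |c i x| ≤ F)
    (hgc : ∀ i, ∀ x ∈ X, ‖c' i x‖ ≤ Mc)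
    (hcL : ∀ i, ∀ x ∈ X, ∀ y ∈ X, ‖c' i x - c' i y‖ ≤ Lc * ‖x - y‖)
    -- the random direction `u` with `E[uuᵀ] = I_d`
    {Ω : Type*} [MeasurableSpace Ω] (μu : Measure Ω) [IsProbabilityMeasure μu]
    (u : Ω → EuclideanSpace ℝ (Fin d)) (hu : Measurable u)
    (hmom : Integrable (fun ω => ‖u ω‖ ^ 6) μu)
    (hId : ∀ i j, (∫ ω, u ω i * u ω j ∂μu) = if i = j then (1:ℝ) else 0)
    -- `v` is differentiable and 1-strongly convex w.r.t. the ℓ_q-norm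
    (v : EuclideanSpace ℝ (Fin d) → ℝ)
    (v' : EuclideanSpace ℝ (Fin d) → EuclideanSpace ℝ (Fin d))
    (hv : ∀ z, HasGradientAt v (v' z) z)
    (hsc : ∀ a b, (⟪a - b, v' a - v' b⟫ : ℝ) ≥ (lpNorm q (a - b)) ^ 2)
    -- current iterates and the stochastic gradient `s^k` with error `ε^k = s^k − g_ν(x^k)`
    (xk : EuclideanSpace ℝ (Fin d)) (hxk : xk ∈ X)
    (lamk : Fin m → ℝ) (hlamk : ∀ i, |lamk i| ≤ ρ * F)
    (sk eps : EuclideanSpace ℝ (Fin d))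
    (heps : eps = sk - ∫ ω, ((f (xk + ν • u ω) - f xk) / ν) • u ω ∂μu)
    -- the next primal iterate: minimizer of the linearized proximal subproblem over `X`
    (xk1 : EuclideanSpace ℝ (Fin d)) (hxk1X : xk1 ∈ X)
    (hxk1min : ∀ z ∈ X,
      (⟪sk + ∑ i, (lamk i + μ * c i xk) • c' i xk, xk1⟫ : ℝ) + h xk1
          + (1 / η) * (v xk1 - v xk - (⟪v' xk, xk1 - xk⟫ : ℝ))
        ≤ (⟪sk + ∑ i, (lamk i + μ * c i xk) • c' i xk, z⟫ : ℝ) + h z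
          + (1 / η) * (v z - v xk - (⟪v' xk, z - xk⟫ : ℝ)))
    -- the next dual iterate
    (lamk1 : Fin m → ℝ) (hlamk1 : ∀ i, lamk1 i = lamk i + ρk * c i xk)
    -- the stepsize condition `η L_μ ≤ 1/2`
    (hηL : η * (Lf + m * (μ * Mc ^ 2 + μ * F * Lc + ρ * F * Lc)) ≤ 1 / 2) :
    (lpNorm q (xk1 - xk)) ^ 2
      ≤ 4 * η * (AL f h c μ xk lamk - AL f h c μ xk1 lamk1 + m * ρk * F ^ 2)
        + η ^ 2 * ν ^ 2 * Lf ^ 2 * (∫ ω, ‖u ω‖ ^ 6 ∂μu)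
        + 4 * η ^ 2 * (lpNorm p eps) ^ 2 := by
  have hHC : p.HolderConjugate q :=
    Real.holderConjugate_iff.2 ⟨by linarith, by simpa [one_div] using hpq⟩
  have hq0 : 0 < q := hHC.symm.pos
  have hq2 : q ≤ 2 := by
    have h1 : 1 / p ≤ 1 / 2 := one_div_le_one_div_of_le two_pos hp
    exact (one_div_le_one_div two_pos hq0).1 (by linarith)
  set D := lpNorm q (xk1 - xk)
  set Ep := lpNorm p eps
  set I3 := ∫ ω, ‖u ω‖ ^ 3 ∂μu
  set I6 := ∫ ω, ‖u ω‖ ^ 6 ∂μu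
  have hΔD : ‖xk1 - xk‖ ≤ D := norm_le_lpNorm hq0 hq2 _
  -- optimality of `xk1`
  set pen := ∑ i, (lamk i + μ * c i xk) • c' i xk with hpen
  have hopt : D ^ 2 / η ≤ -⟪sk + pen, xk1 - xk⟫ - (h xk1 - h xk) := by
    have hgrad : HasGradientAt
        (fun z => ⟪sk + pen, z⟫ + (1 / η) * (v z - v xk - ⟪v' xk, z - xk⟫))
        (sk + pen + (1 / η) • (v' xk1 - v' xk)) xk1 := by
      rw [hasGradientAt_iff_hasFDerivAt]
      have h1 := (innerSL ℝ (sk + pen)).hasFDerivAt (x := xk1)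
      have h2 := (innerSL ℝ (v' xk)).hasFDerivAt.comp xk1 ((hasFDerivAt_id xk1).sub_const xk)
      refine (h1.add ((((hv xk1).hasFDerivAt.sub_const (v xk)).sub h2).const_mul
        (1 / η))).congr_fderiv ?_
      ext z
      simp
    have hfo := inner_gradient_add_sub_nonneg_of_isMinOn hXconv hgrad hconv hxk1X hxk
      (isMinOn_iff.2 fun z hz => by linarith [hxk1min z hz])
    have hs := hsc xk1 xk
    rw [real_inner_comm] at hs
    rw [← neg_sub xk1 xk, inner_neg_right, inner_add_left, inner_smul_left] at hfo
    have := mul_le_mul_of_nonneg_left hs (one_div_nonneg.2 hη.le)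
    simp only [conj_trivial] at hfo
    rw [div_eq_inv_mul, ← one_div]
    linarith
  -- smoothness of the differentiable part of the augmented Lagrangian
  set Lμ := Lf + m * (μ * Mc ^ 2 + μ * F * Lc + ρ * F * Lc) with hLμ
  have hdesc := (le_abs_self _).trans (abs_sub_sub_inner_le_of_lipschitz_gradient hXconv
    (fun x => hasGradientAt_add_sum_penalty (hdf x) (fun i => hdc i x) μ lamk)
    (fun x hx y hy => norm_gradient_add_sum_penalty_sub_le hXconv hμ.le
      (fun x _ y _ => hLf x y) hdc hcF hgc hcL hlamk hx hy) hxk hxk1X)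
  rw [Fintype.card_fin, ← hLμ, ← hpen] at hdesc
  have hLD : Lμ / 2 * ‖xk1 - xk‖ ^ 2 ≤ D ^ 2 / (4 * η) := by
    rw [le_div_iff₀ (by positivity)]
    calc Lμ / 2 * ‖xk1 - xk‖ ^ 2 * (4 * η) = 2 * (η * Lμ) * ‖xk1 - xk‖ ^ 2 := by ring
      _ ≤ 1 * ‖xk1 - xk‖ ^ 2 := by gcongr; linarith
      _ ≤ D ^ 2 := by rw [one_mul]; gcongr
  have hbias : ⟪f' xk - (sk - eps), xk1 - xk⟫ ≤ D ^ 2 / (4 * η) + η * ν ^ 2 * Lf ^ 2 / 4 * I6 := by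
    have hmom3 : Integrable (fun ω => ‖u ω‖ ^ 3) μu := by
      refine ((integrable_const (1 : ℝ)).fun_add hmom).mono' (by fun_prop) (.of_forall fun ω => ?_)
      rw [Real.norm_of_nonneg (by positivity)]
      nlinarith [sq_nonneg (‖u ω‖ ^ 3 - 1)]
    have hJ : I3 ^ 2 ≤ I6 := by
      have hint : ∫ ω, (‖u ω‖ ^ 6 - 2 * I3 * ‖u ω‖ ^ 3 + I3 ^ 2) ∂μu = I6 - I3 ^ 2 := by
        rw [integral_add (f := fun ω => ‖u ω‖ ^ 6 - 2 * I3 * ‖u ω‖ ^ 3)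
            (hmom.sub (hmom3.const_mul _)) (integrable_const _),
          integral_sub hmom (hmom3.const_mul _), integral_const_mul]
        simp
        ring
      have := integral_nonneg (μ := μu)
        (f := fun ω => ‖u ω‖ ^ 6 - 2 * I3 * ‖u ω‖ ^ 3 + I3 ^ 2)
        fun ω => by simp only [Pi.zero_apply]; nlinarith [sq_nonneg (‖u ω‖ ^ 3 - I3)]
      linarith
    have hb := inner_sub_smoothed_gradient_le hν hdf hLf hu hmom3 hId xk (xk1 - xk)
    rw [heps, sub_sub_cancel]
    refine hb.trans ?_
    set w := ‖xk1 - xk‖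
    have hw : w ^ 2 ≤ D ^ 2 := by gcongr
    have hyoung : ν * Lf / 2 * I3 * w ≤ w ^ 2 / (4 * η) + η * (ν * Lf / 2 * I3) ^ 2 := by
      have : w ^ 2 / (4 * η) + η * (ν * Lf / 2 * I3) ^ 2 - ν * Lf / 2 * I3 * w
          = (w - 2 * η * (ν * Lf / 2 * I3)) ^ 2 / (4 * η) := by field_simp; ring
      have : 0 ≤ (w - 2 * η * (ν * Lf / 2 * I3)) ^ 2 / (4 * η) := by positivity
      linarith
    refine hyoung.trans (add_le_add (by gcongr) ?_)
    calc η * (ν * Lf / 2 * I3) ^ 2 = η * ν ^ 2 * Lf ^ 2 / 4 * I3 ^ 2 := by ring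
      _ ≤ η * ν ^ 2 * Lf ^ 2 / 4 * I6 := by gcongr
  have herr : -⟪eps, xk1 - xk⟫ ≤ D ^ 2 / (4 * η) + η * Ep ^ 2 := by
    have h1 := (neg_le_abs _).trans (abs_inner_le_lpNorm_mul_lpNorm hHC eps (xk1 - xk))
    have h2 : D ^ 2 / (4 * η) + η * Ep ^ 2 - Ep * D = (D - 2 * η * Ep) ^ 2 / (4 * η) := by
      field_simp; ring
    have h3 : 0 ≤ (D - 2 * η * Ep) ^ 2 / (4 * η) := by positivity
    linarith
  have hdual : AL f h c μ xk1 lamk1 ≤ AL f h c μ xk1 lamk + m * ρk * F ^ 2 := by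
    have hprod : ∑ i, c i xk * c i xk1 ≤ m * F ^ 2 := by
      have : ∀ i ∈ univ, c i xk * c i xk1 ≤ F ^ 2 := fun i _ => by
        have hF : 0 ≤ F := (abs_nonneg _).trans (hcF i xk hxk)
        refine (le_abs_self _).trans ?_
        rw [abs_mul, sq]
        exact mul_le_mul (hcF i xk hxk) (hcF i xk1 hxk1X) (abs_nonneg _) hF
      simpa using sum_le_card_nsmul univ _ _ this
    have hsum : ∑ i, lamk1 i * c i xk1
        = ∑ i, lamk i * c i xk1 + ρk * ∑ i, c i xk * c i xk1 := by
      simp_rw [hlamk1, add_mul, sum_add_distrib, mul_sum, mul_assoc]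
    have := mul_le_mul_of_nonneg_left hprod hρk
    simp only [AL, hsum]
    linarith
  have hsplit : ⟪f' xk + pen, xk1 - xk⟫ = ⟪sk + pen, xk1 - xk⟫
      + ⟪f' xk - (sk - eps), xk1 - xk⟫ - ⟪eps, xk1 - xk⟫ := by
    rw [← inner_add_left, ← inner_sub_left]
    congr 1
    abel
  have hmain : D ^ 2 / (4 * η) ≤ AL f h c μ xk lamk - AL f h c μ xk1 lamk1 + m * ρk * F ^ 2
      + η * ν ^ 2 * Lf ^ 2 / 4 * I6 + η * Ep ^ 2 := by
    have hquarter : D ^ 2 / η = 4 * (D ^ 2 / (4 * η)) := by field_simp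
    simp only [AL] at hdual ⊢
    linarith
  rw [div_le_iff₀ (by positivity)] at hmain
  linarith
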